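/- Suppose condition (⋆⋆) holds and g is a simple graph on {1,…,n} with η_i(g) = k_i for every firm i. Then for every pair of distinct vertices ij that is not an edge of g, Y_i(g + ij) ≤ Y_i(g); that is, no firm can increase its total profit across the spatial markets by adding a new collaboration link. -/

import Mathlib

open Finset

noncomputable def degree' {n : ℕ} (g : SimpleGraph (Fin n)) (i : Fin n) : ℕ :=
  Nat.card {j | g.Adj i j}

/-- The graph `g` with the edge `ij` deleted. -/
def delE {n : ℕ} (g : SimpleGraph (Fin n)) (i j : Fin n) : SimpleGraph (Fin n) :=
  g.deleteEdges {s(i, j)}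

/-- The graph `g` with the edge `ij` added. -/
def addE {n : ℕ} (g : SimpleGraph (Fin n)) (i j : Fin n) : SimpleGraph (Fin n) :=
  g ⊔ SimpleGraph.fromEdgeSet {s(i, j)}

/-- Marginal production cost of firm `i` under collaboration graph `g`. -/
noncomputable def cost {n : ℕ} (γ₀ : ℝ) (f : ℝ → ℝ) (k : Fin n → ℕ)
    (g : SimpleGraph (Fin n)) (i : Fin n) : ℝ :=
  γ₀ + f ((degree' g i : ℝ) - (k i : ℝ))

/-- Cournot equilibrium quantity shipped by firm `i` to market node `l`
under collaboration graph `g`. -/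
noncomputable def dq {n : ℕ} {V : Type*} [Fintype V] (αl : V → ℝ) (γ₀ : ℝ)
    (s : V → Fin n → ℝ) (f : ℝ → ℝ) (k : Fin n → ℕ)
    (g : SimpleGraph (Fin n)) (l : V) (i : Fin n) : ℝ :=
  (αl l - γ₀ - n * (s l i + f ((degree' g i : ℝ) - (k i : ℝ)))
    + ∑ j ∈ univ.erase i, (s l j + f ((degree' g j : ℝ) - (k j : ℝ)))) / (n + 1)

/-- Price at market node `l` under collaboration graph `g`. -/
noncomputable def priceAt {n : ℕ} {V : Type*} [Fintype V] (αl : V → ℝ) (γ₀ : ℝ)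
    (s : V → Fin n → ℝ) (f : ℝ → ℝ) (k : Fin n → ℕ)
    (g : SimpleGraph (Fin n)) (l : V) : ℝ :=
  αl l - ∑ i, dq αl γ₀ s f k g l i

/-- Profit of firm `i` at market node `l` under collaboration graph `g`. -/
noncomputable def profitAt {n : ℕ} {V : Type*} [Fintype V] (αl : V → ℝ) (γ₀ : ℝ)
    (s : V → Fin n → ℝ) (f : ℝ → ℝ) (k : Fin n → ℕ)
    (g : SimpleGraph (Fin n)) (l : V) (i : Fin n) : ℝ :=
  dq αl γ₀ s f k g l i * (priceAt αl γ₀ s f k g l - cost γ₀ f k g i - s l i)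

/-- Total profit of firm `i` across all spatial markets under collaboration graph `g`. -/
noncomputable def totProfit {n : ℕ} {V : Type*} [Fintype V] (αl : V → ℝ) (γ₀ : ℝ)
    (s : V → Fin n → ℝ) (f : ℝ → ℝ) (k : Fin n → ℕ)
    (g : SimpleGraph (Fin n)) (i : Fin n) : ℝ :=
  ∑ l, profitAt αl γ₀ s f k g l i

theorem addE_comm {n : ℕ} (g : SimpleGraph (Fin n)) (i j : Fin n) :
    addE g i j = addE g j i := by
  simp only [addE, Sym2.eq_swap]

theorem degree'_addE_left {n : ℕ} (g : SimpleGraph (Fin n)) {i j : Fin n} (hne : i ≠ j)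
    (hij : ¬ g.Adj i j) : degree' (addE g i j) i = degree' g i + 1 := by
  have h : {m | (addE g i j).Adj i m} = insert j {m | g.Adj i m} := by
    ext m
    simp only [addE, SimpleGraph.sup_adj, SimpleGraph.fromEdgeSet_adj, Set.mem_singleton_iff,
      Set.mem_ofPred_eq, Set.mem_insert_iff, Sym2.eq_iff]
    grind
  rw [degree', degree', h, Nat.card_coe_set_eq, Nat.card_coe_set_eq,
    Set.ncard_insert_of_notMem (s := {m | g.Adj i m}) hij (Set.toFinite _)]

theorem degree'_addE_right {n : ℕ} (g : SimpleGraph (Fin n)) {i j : Fin n} (hne : i ≠ j)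
    (hij : ¬ g.Adj i j) : degree' (addE g i j) j = degree' g j + 1 := by
  rw [addE_comm]
  exact degree'_addE_left g hne.symm fun h => hij h.symm

theorem degree'_addE_of_ne {n : ℕ} (g : SimpleGraph (Fin n)) {i j m : Fin n} (hi : m ≠ i)
    (hj : m ≠ j) : degree' (addE g i j) m = degree' g m := by
  have h : {p | (addE g i j).Adj m p} = {p | g.Adj m p} := by
    ext p
    simp only [addE, SimpleGraph.sup_adj, SimpleGraph.fromEdgeSet_adj, Set.mem_singleton_iff,
      Set.mem_ofPred_eq, Sym2.eq_iff]
    grind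
  rw [degree', degree', h]

/-- At the Cournot equilibrium the profit of a firm at a node is the square of its quantity. -/
theorem profitAt_eq_sq {n : ℕ} {V : Type*} [Fintype V] (αl : V → ℝ) (γ₀ : ℝ)
    (s : V → Fin n → ℝ) (f : ℝ → ℝ) (k : Fin n → ℕ) (g : SimpleGraph (Fin n)) (l : V)
    (i : Fin n) : profitAt αl γ₀ s f k g l i = dq αl γ₀ s f k g l i ^ 2 := by
  have hn : (n : ℝ) + 1 ≠ 0 := by positivity
  set t : Fin n → ℝ := fun m => s l m + f ((degree' g m : ℝ) - (k m : ℝ)) with ht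
  have hd (m : Fin n) :
      dq αl γ₀ s f k g l m = (αl l - γ₀ - (n + 1) * t m + ∑ p, t p) / (n + 1) := by
    have h := Finset.add_sum_erase univ t (Finset.mem_univ m)
    rw [dq, ← h]
    simp only [ht]
    ring
  have hsum : ∑ m, dq αl γ₀ s f k g l m = (n * (αl l - γ₀) - ∑ p, t p) / (n + 1) := by
    simp only [hd, ← Finset.sum_div, Finset.sum_add_distrib, Finset.sum_sub_distrib,
      ← Finset.mul_sum, Finset.sum_const, Finset.card_univ, Fintype.card_fin, nsmul_eq_mul]
    ring
  have hmargin : priceAt αl γ₀ s f k g l - cost γ₀ f k g i - s l i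
      = dq αl γ₀ s f k g l i := by
    rw [priceAt, hsum, hd i, cost]
    simp only [ht]
    field_simp
    ring
  rw [profitAt, hmargin, sq]

/-- Adding a link to a graph with optimal degrees lowers the quantity shipped by its end. -/
theorem dq_addE {n : ℕ} {V : Type*} [Fintype V] (αl : V → ℝ) (γ₀ : ℝ)
    (s : V → Fin n → ℝ) (f : ℝ → ℝ) (k : Fin n → ℕ) (g : SimpleGraph (Fin n))
    (hdeg : ∀ i, degree' g i = k i) {i j : Fin n} (hne : i ≠ j) (hij : ¬ g.Adj i j) (l : V) :
    dq αl γ₀ s f k (addE g i j) l i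
      = dq αl γ₀ s f k g l i - (n - 1) * (f 1 - f 0) / (n + 1) := by
  have hj : j ∈ univ.erase i := by simp [hne.symm]
  have hrest : ∑ m ∈ (univ.erase i).erase j,
        (s l m + f ((degree' (addE g i j) m : ℝ) - (k m : ℝ)))
      = ∑ m ∈ (univ.erase i).erase j, (s l m + f ((degree' g m : ℝ) - (k m : ℝ))) := by
    refine Finset.sum_congr rfl fun m hm => ?_
    rw [Finset.mem_erase, Finset.mem_erase] at hm
    rw [degree'_addE_of_ne g hm.2.1 hm.1]
  simp only [dq]
  rw [← Finset.add_sum_erase _ _ hj, ← Finset.add_sum_erase _ _ hj, hrest,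
    degree'_addE_left g hne hij, degree'_addE_right g hne hij, hdeg i, hdeg j]
  push_cast
  simp only [add_sub_cancel_left, sub_self]
  ring

/-- under condition (⋆⋆), no firm gains total profit by adding a link. -/
theorem stmt17 (n : ℕ) (hn : 2 ≤ n) (V : Type*) [Fintype V] (αl : V → ℝ) (γ₀ : ℝ)
    (s : V → Fin n → ℝ) (hs : ∀ l i, 0 ≤ s l i) (f : ℝ → ℝ)
    (hconv : ConvexOn ℝ Set.univ f) (hf0 : ∀ x, 0 ≤ f x) (hfmin : ∀ x, f 0 ≤ f x)
    (k : Fin n → ℕ) (hk : ∀ i, k i ≤ n - 1)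
    (M : ℝ) (hM : IsGreatest (Set.range fun p : V × Fin n => s p.1 p.2) M)
    (hstar : ∀ l : V, 0 < αl l - γ₀ - n * (M + max (f ((n : ℝ) - 1)) (f (1 - (n : ℝ))))
      - (((n : ℝ) - 1) / 2) * max (f 1 - f 0) (f (-1) - f 0))
    (g : SimpleGraph (Fin n)) (hdeg : ∀ i, degree' g i = k i)
    (i j : Fin n) (hne : i ≠ j) (hij : ¬ g.Adj i j) :
    totProfit αl γ₀ s f k (addE g i j) i ≤ totProfit αl γ₀ s f k g i := by
  have hn' : (2 : ℝ) ≤ n := by exact_mod_cast hn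
  have hδ : 0 ≤ f 1 - f 0 := sub_nonneg.2 (hfmin 1)
  refine Finset.sum_le_sum fun l _ => ?_
  rw [profitAt_eq_sq, profitAt_eq_sq, dq_addE αl γ₀ s f k g hdeg hne hij l]
  have hsM : s l i ≤ M := hM.2 ⟨(l, i), rfl⟩
  have hcost : n * (s l i + f 0)
      ≤ n * (M + max (f ((n : ℝ) - 1)) (f (1 - (n : ℝ)))) := by
    gcongr
    exact (hfmin _).trans (le_max_left _ _)
  have hloss : ((n : ℝ) - 1) / 2 * (f 1 - f 0)
      ≤ ((n : ℝ) - 1) / 2 * max (f 1 - f 0) (f (-1) - f 0) :=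
    mul_le_mul_of_nonneg_left (le_max_left _ _) (by linarith)
  have hothers : 0 ≤ ∑ m ∈ univ.erase i, (s l m + f ((degree' g m : ℝ) - (k m : ℝ))) :=
    Finset.sum_nonneg fun m _ => add_nonneg (hs l m) (hf0 _)
  have hquantity : ((n : ℝ) - 1) * (f 1 - f 0) / (n + 1) ≤ 2 * dq αl γ₀ s f k g l i := by
    rw [dq, ← mul_div_assoc, hdeg i, sub_self]
    refine div_le_div_of_nonneg_right ?_ (by linarith)
    linarith [hstar l]
  have hdrop : 0 ≤ ((n : ℝ) - 1) * (f 1 - f 0) / (n + 1) :=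
    div_nonneg (mul_nonneg (by linarith) hδ) (by linarith)
  nlinarith [mul_nonneg hdrop (sub_nonneg.2 hquantity)]
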